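/- Suppose f : ℝ^p → ℝ satisfies Assumption (KL-MR), and set ρ = β / max{θ(β+2), 1}. Then there exists C > 0 such that for every ε ∈ [0, ε̄], every bounded ε-biased gradient curve x : [0,∞) → ℝ^p of f, and every accumulation point z of x (i.e., z = lim_{n→∞} x(t_n) for some sequence t_n → ∞), one has dist(z, crit f) ≤ C ε^ρ. -/

import Mathlib

open Filter MeasureTheory Metric Set Topology
open scoped ENNReal NNReal

abbrev Ep (p : ℕ) := EuclideanSpace ℝ (Fin p)

def critSet {p : ℕ} (f : Ep p → ℝ) (ε : ℝ) : Set (Ep p) := {x | ‖gradient f x‖ ≤ ε}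

def vcritSet {p : ℕ} (f : Ep p → ℝ) (ε : ℝ) : Set ℝ := f '' critSet f ε

/-- An `ε`-biased gradient curve of `f` on the interval `I ⊆ [0,∞)`: a locally Lipschitz
curve on `I` which is differentiable a.e. on `I` with `‖x'(t) + ∇f(x(t))‖ ≤ ε`. -/
def IsBiasedGradCurve {p : ℕ} (f : Ep p → ℝ) (ε : ℝ) (I : Set ℝ) (x : ℝ → Ep p) : Prop :=
  (∀ t ∈ I, ∃ K : NNReal, ∃ s ∈ nhdsWithin t I, LipschitzOnWith K x s) ∧
  ∀ᵐ t ∂(volume.restrict I), DifferentiableAt ℝ x t ∧ ‖deriv x t + gradient f (x t)‖ ≤ ε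

theorem le_of_ae_deriv_nonpos {h : ℝ → ℝ} {K : ℝ≥0} {a b : ℝ} (hab : a ≤ b)
    (hK : LipschitzOnWith K h (Icc a b))
    (hd : ∀ᵐ t ∂(volume.restrict (Icc a b)), deriv h t ≤ 0) : h b ≤ h a := by
  have hac : AbsolutelyContinuousOnInterval h a b := by
    refine LipschitzOnWith.absolutelyContinuousOnInterval (K := K) ?_
    rwa [uIcc_of_le hab]
  have hint := hac.integral_deriv_eq_sub
  rw [intervalIntegral.integral_of_le hab] at hint
  have hd' : ∀ᵐ t ∂(volume.restrict (Ioc a b)), deriv h t ≤ 0 :=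
    ae_restrict_of_ae_restrict_of_subset Ioc_subset_Icc_self hd
  have := integral_nonpos_of_ae hd'
  linarith

section Curve

variable {p : ℕ} {f : Ep p → ℝ} {ε : ℝ} {x : ℝ → Ep p}

theorem continuous_gradient_of_contDiff (hf : ContDiff ℝ 1 f) : Continuous (gradient f) :=
  (InnerProductSpace.toDual ℝ (Ep p)).symm.continuous.comp (hf.continuous_fderiv one_ne_zero)

theorem IsBiasedGradCurve.exists_lipschitzOnWith (hx : IsBiasedGradCurve f ε (Ici 0) x)
    {a : ℝ} (ha : 0 ≤ a) (b : ℝ) : ∃ K, LipschitzOnWith K x (Icc a b) := by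
  have hloc : LocallyLipschitzOn (Ici 0) x := fun t ht => hx.1 t ht
  exact (hloc.mono fun t ht => ha.trans ht.1).exists_lipschitzOnWith_of_compact isCompact_Icc

theorem IsBiasedGradCurve.continuousOn (hx : IsBiasedGradCurve f ε (Ici 0) x) :
    ContinuousOn x (Ici 0) := by
  have hloc : LocallyLipschitzOn (Ici 0) x := fun t ht => hx.1 t ht
  exact hloc.continuousOn

theorem IsBiasedGradCurve.add_inner_add_mul_le (hx : IsBiasedGradCurve f ε (Ici 0) x)
    (hf : Differentiable ℝ f) {L : ℝ≥0} (hL : LipschitzWith L f) {a b : ℝ} (ha : 0 ≤ a)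
    (hab : a ≤ b) (e : Ep p) (μ : ℝ)
    (h : ∀ t ∈ Icc a b, ∀ v : Ep p, ‖v + gradient f (x t)‖ ≤ ε →
      inner ℝ (gradient f (x t)) v + inner ℝ e v + μ ≤ 0) :
    f (x b) + inner ℝ e (x b) + μ * b ≤ f (x a) + inner ℝ e (x a) + μ * a := by
  obtain ⟨K, hK⟩ := hx.exists_lipschitzOnWith ha b
  have h1 := hL.comp_lipschitzOnWith hK
  have h2 := (innerSL ℝ e).lipschitz.comp_lipschitzOnWith hK
  have h3 : LipschitzOnWith _ (fun t : ℝ => μ * t) (Icc a b) :=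
    (ContinuousLinearMap.lipschitz (ContinuousLinearMap.mul ℝ ℝ μ)).lipschitzOnWith
  have hlip := (h1.add h2).add h3
  refine le_of_ae_deriv_nonpos (h := fun t => f (x t) + inner ℝ e (x t) + μ * t) hab hlip ?_
  have hae := ae_restrict_of_ae_restrict_of_subset
    (show Icc a b ⊆ Ici (0 : ℝ) from fun t ht => ha.trans ht.1) hx.2
  filter_upwards [hae, ae_restrict_mem measurableSet_Icc] with t ht htm
  have hxd := ht.1.hasDerivAt
  have d1 : HasDerivAt (fun t => f (x t)) (inner ℝ (gradient f (x t)) (deriv x t)) t := by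
    exact (hf (x t)).hasGradientAt.hasFDerivAt.comp_hasDerivAt t hxd
  have d2 : HasDerivAt (fun t => (inner ℝ e (x t) : ℝ)) (inner ℝ e (deriv x t)) t := by
    exact (innerSL ℝ e).hasFDerivAt.comp_hasDerivAt t hxd
  have d3 : HasDerivAt (fun t : ℝ => μ * t) μ t := by
    simpa using (hasDerivAt_id t).const_mul μ
  refine le_of_eq_of_le ((d1.fun_add d2).fun_add d3).deriv ?_
  exact h t htm _ ht.2

theorem inner_le_of_norm_add_le {g v : Ep p} (h : ‖v + g‖ ≤ ε) :
    inner ℝ g v ≤ -(‖g‖ * (‖g‖ - ε)) := by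
  have h1 : (inner ℝ g v : ℝ) = inner ℝ g (v + g) - ‖g‖ ^ 2 := by
    rw [inner_add_right, real_inner_self_eq_norm_sq]; ring
  have h2 := real_inner_le_norm g (v + g)
  nlinarith [norm_nonneg g]

theorem IsBiasedGradCurve.le_of_le_norm_gradient (hx : IsBiasedGradCurve f ε (Ici 0) x)
    (hf : Differentiable ℝ f) {L : ℝ≥0} (hL : LipschitzWith L f) {a b : ℝ} (ha : 0 ≤ a)
    (hab : a ≤ b) {g : ℝ} (_hg : 0 ≤ g) (hεg : ε ≤ g)
    (h : ∀ t ∈ Icc a b, g ≤ ‖gradient f (x t)‖) :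
    f (x b) + g * (g - ε) * (b - a) ≤ f (x a) := by
  have := hx.add_inner_add_mul_le hf hL ha hab 0 (g * (g - ε)) (fun t ht v hv => by
    have h1 := inner_le_of_norm_add_le hv
    have h2 := h t ht
    have h3 : g * (g - ε) ≤ ‖gradient f (x t)‖ * (‖gradient f (x t)‖ - ε) := by gcongr
    rw [inner_zero_left]
    linarith)
  simp only [inner_zero_left] at this
  linarith

theorem IsBiasedGradCurve.dist_le_of_le_norm_gradient (hx : IsBiasedGradCurve f ε (Ici 0) x)
    (hε : 0 ≤ ε) (hf : Differentiable ℝ f) {L : ℝ≥0} (hL : LipschitzWith L f) {a b : ℝ}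
    (ha : 0 ≤ a) (hab : a ≤ b) {g : ℝ} (hεg : ε ≤ g)
    (h : ∀ t ∈ Icc a b, g ≤ ‖gradient f (x t)‖) :
    f (x b) + (g - ε) / 2 * ‖x b - x a‖ ≤ f (x a) := by
  set w : Ep p := ‖x b - x a‖⁻¹ • (x b - x a) with hw
  have hwn : ‖w‖ ≤ 1 := by
    rw [hw, norm_smul, norm_inv, norm_norm]
    exact inv_mul_le_one
  have hwi : inner ℝ w (x b - x a) = ‖x b - x a‖ := by
    rw [hw, real_inner_smul_left, real_inner_self_eq_norm_sq]
    by_cases h0 : ‖x b - x a‖ = 0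
    · simp [h0]
    · field_simp
  have := hx.add_inner_add_mul_le hf hL ha hab (((g - ε) / 2) • w) 0 (fun t ht v hv => by
    have h1 := inner_le_of_norm_add_le hv
    have h2 := h t ht
    set G := ‖gradient f (x t)‖
    have h3 : ‖v‖ ≤ ε + G := by
      calc ‖v‖ = ‖(v + gradient f (x t)) - gradient f (x t)‖ := by rw [add_sub_cancel_right]
        _ ≤ ‖v + gradient f (x t)‖ + G := norm_sub_le _ _
        _ ≤ ε + G := by gcongr
    have h4 : inner ℝ w v ≤ ε + G := by
      refine (real_inner_le_norm w v).trans ?_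
      nlinarith [norm_nonneg v]
    rw [real_inner_smul_left]
    nlinarith [mul_nonneg (sub_nonneg.2 hεg) (sub_nonneg.2 h4), norm_nonneg v])
  rw [real_inner_smul_left w (x b), real_inner_smul_left w (x a)] at this
  rw [← hwi, inner_sub_right]
  linarith

theorem IsBiasedGradCurve.le_of_notMem_vcritSet (hx : IsBiasedGradCurve f ε (Ici 0) x)
    (hε : 0 ≤ ε) (hf : Differentiable ℝ f) {L : ℝ≥0} (hL : LipschitzWith L f)
    (hV : IsClosed (vcritSet f ε)) {v : ℝ} (hv : v ∉ vcritSet f ε) {s t : ℝ} (hs : 0 ≤ s)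
    (hst : s ≤ t) (hsv : f (x s) ≤ v) : f (x t) ≤ v := by
  have hc : ContinuousOn (fun τ => f (x τ)) (Ici 0) :=
    hf.continuous.comp_continuousOn hx.continuousOn
  have hcst : ContinuousOn (fun τ => f (x τ)) (Icc s t) :=
    hc.mono fun τ hτ => hs.trans hτ.1
  have hcl : IsClosed ({τ | f (x τ) ≤ v} ∩ Icc s t) := by
    have := hcst.preimage_isClosed_of_isClosed isClosed_Icc (isClosed_Iic (a := v))
    rwa [inter_comm] at this
  refine hcl.Icc_subset_of_forall_exists_gt hsv ?_ ⟨hst, le_rfl⟩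
  rintro τ ⟨hτv, hτ⟩ y hy
  have hτ0 : 0 ≤ τ := hs.trans hτ.1
  have hcτ : Tendsto (fun τ => f (x τ)) (𝓝[≥] τ) (𝓝 (f (x τ))) :=
    (hc τ hτ0).mono_left (nhdsWithin_mono _ (Ici_subset_Ici.2 hτ0))
  have key : ∃ q > τ, ∀ r ∈ Icc τ q, f (x r) < v ∨ f (x r) ∉ vcritSet f ε := by
    have hopen : Iio v ∪ (vcritSet f ε)ᶜ ∈ 𝓝 (f (x τ)) := by
      refine (isOpen_Iio.union hV.isOpen_compl).mem_nhds ?_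
      rcases (show f (x τ) ≤ v from hτv).lt_or_eq with h | h
      · exact Or.inl h
      · exact Or.inr (h ▸ hv)
    have := hcτ hopen
    rw [Filter.mem_map, mem_nhdsGE_iff_exists_Icc_subset] at this
    obtain ⟨q, hq, hsub⟩ := this
    exact ⟨q, hq, fun r hr => hsub hr⟩
  obtain ⟨q, hq, hr⟩ := key
  have hm : τ < min q y := lt_min hq hy
  by_cases hex : ∃ r ∈ Ioc τ (min q y), f (x r) < v
  · obtain ⟨r, hr1, hr2⟩ := hex
    exact ⟨r, hr2.le, hr1.1, hr1.2.trans (min_le_right _ _)⟩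
  · push Not at hex
    refine ⟨min q y, ?_, hm, min_le_right _ _⟩
    have hgr : ∀ r ∈ Ioc τ (min q y), ε ≤ ‖gradient f (x r)‖ := by
      intro r hr1
      have hnm := (hr r ⟨hr1.1.le, hr1.2.trans (min_le_left _ _)⟩).resolve_left
        (not_lt.2 (hex r hr1))
      by_contra hcon
      exact hnm ⟨x r, (not_le.1 hcon).le, rfl⟩
    have hle : ∀ r ∈ Ioo τ (min q y), f (x (min q y)) ≤ f (x r) := by
      intro r hr1
      have := hx.le_of_le_norm_gradient hf hL (hτ0.trans hr1.1.le) hr1.2.le hε le_rfl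
        fun r' hr' => hgr r' ⟨hr1.1.trans_le hr'.1, hr'.2⟩
      simpa using this
    have hlim : Tendsto (fun r => f (x r)) (𝓝[>] τ) (𝓝 (f (x τ))) :=
      hcτ.mono_left (nhdsWithin_mono _ Ioi_subset_Ici_self)
    have : f (x (min q y)) ≤ f (x τ) :=
      ge_of_tendsto hlim (by filter_upwards [Ioo_mem_nhdsGT hm] with r hr using hle r hr)
    exact this.trans hτv

theorem exists_first_eq_of_continuousOn {D : ℝ → ℝ} {s t₁ r : ℝ} (hst : s ≤ t₁)
    (hD : ContinuousOn D (Icc s t₁)) (hs : D s ≤ r) (ht₁ : r ≤ D t₁) :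
    ∃ t, s ≤ t ∧ D t = r ∧ ∀ τ ∈ Icc s t, D τ ≤ r := by
  have hcl : IsClosed (Icc s t₁ ∩ D ⁻¹' Ici r) := hD.preimage_isClosed_of_isClosed isClosed_Icc
    isClosed_Ici
  obtain ⟨t, ⟨htm, htr⟩, hleast⟩ := (isCompact_Icc.of_isClosed_subset hcl
    inter_subset_left).exists_isLeast ⟨t₁, ⟨hst, le_rfl⟩, ht₁⟩
  have hsub : Icc s t ⊆ Icc s t₁ := Icc_subset_Icc_right htm.2
  have hDt : D t = r := by
    obtain ⟨τ, hτ, hτr⟩ := intermediate_value_Icc htm.1 (hD.mono hsub) ⟨hs, htr⟩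
    have : t ≤ τ := hleast ⟨hsub hτ, hτr.ge⟩
    rwa [le_antisymm this hτ.2]
  refine ⟨t, htm.1, hDt, fun τ hτ => ?_⟩
  by_contra hcon
  have : t ≤ τ := hleast ⟨hsub hτ, (not_le.1 hcon).le⟩
  rw [le_antisymm hτ.2 this] at hcon
  exact hcon hDt.le

theorem mem_Icc_of_mapClusterPt (hf : Continuous f) {ℓ u : ℝ}
    (hev : ∀ η > 0, ∀ᶠ t in atTop, f (x t) ∈ Icc (ℓ - η) (u + η)) {w : Ep p}
    (hw : MapClusterPt w atTop x) : f w ∈ Icc ℓ u := by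
  have hfw : MapClusterPt (f w) atTop (f ∘ x) := hw.tendsto_comp hf.continuousAt
  have key : ∀ η > 0, f w ∈ Icc (ℓ - η) (u + η) := fun η hη =>
    isClosed_Icc.mem_of_mapClusterPt hfw (hev η hη)
  exact ⟨le_of_forall_pos_le_add fun η hη => by linarith [(key η hη).1],
    le_of_forall_pos_le_add fun η hη => (key η hη).2⟩

theorem IsBiasedGradCurve.mul_le_of_forall_mapClusterPt (hx : IsBiasedGradCurve f ε (Ici 0) x)
    (hε : 0 ≤ ε) (hf : ContDiff ℝ 1 f) {L : ℝ≥0} (hL : LipschitzWith L f) {ℓ u : ℝ}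
    (hev : ∀ η > 0, ∀ᶠ t in atTop, f (x t) ∈ Icc (ℓ - η) (u + η)) {z : Ep p}
    (hz : MapClusterPt z atTop x) {r g : ℝ} (hr : 0 < r) (hg : ε < g)
    (h : ∀ w ∈ closedBall z r, MapClusterPt w atTop x → g < ‖gradient f w‖) :
    (g - ε) / 2 * r ≤ u - ℓ := by
  have hfd : Differentiable ℝ f := hf.differentiable one_ne_zero
  have hgc := continuous_gradient_of_contDiff hf
  have hS : ∀ᶠ t in atTop, x t ∉ closedBall z r ∩ {w | ‖gradient f w‖ ≤ g} := by
    by_contra hcon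
    have hfr : ∃ᶠ t in atTop, x t ∈ closedBall z r ∩ {w | ‖gradient f w‖ ≤ g} := by
      simpa [Filter.Frequently] using hcon
    obtain ⟨w, hw, hwc⟩ := ((isCompact_closedBall z r).inter_right
      (isClosed_le hgc.norm continuous_const)).exists_mapClusterPt_of_frequently hfr
    exact absurd (h w hw.1 hwc) (not_lt.2 hw.2)
  have key : ∀ η ∈ Ioo 0 r, (g - ε) / 2 * (r - η) ≤ u - ℓ + 2 * η := by
    rintro η ⟨hη, hηr⟩
    obtain ⟨T, hT⟩ := eventually_atTop.1 ((hS.and (hev η hη)).and (eventually_ge_atTop 0))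
    obtain ⟨s, hsT, hs⟩ := frequently_atTop.1
      (mapClusterPt_iff_frequently.1 hz _ (ball_mem_nhds z hη)) T
    have hs0 : 0 ≤ s := (hT s hsT).2
    have hgrad : ∀ t ≥ s, dist (x t) z ≤ r → g ≤ ‖gradient f (x t)‖ := fun t ht hd => by
      by_contra hcon
      exact (hT t (hsT.trans ht)).1.1 ⟨hd, (not_le.1 hcon).le⟩
    have hleave : ∃ t ≥ s, r ≤ dist (x t) z := by
      by_contra! hcon
      have hpos : 0 < g * (g - ε) := mul_pos (hε.trans_lt hg) (sub_pos.2 hg)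
      obtain ⟨n, hn⟩ := exists_nat_gt ((u - ℓ + 2 * η) / (g * (g - ε)))
      rw [div_lt_iff₀ hpos] at hn
      have hst : s ≤ s + n := by simp
      have h1 := hx.le_of_le_norm_gradient hfd hL hs0 hst (hε.trans hg.le) hg.le
        fun t ht => hgrad t ht.1 (hcon t ht.1).le
      have h2 := (hT s hsT).1.2.2
      have h3 := (hT (s + n) (hsT.trans hst)).1.2.1
      rw [add_sub_cancel_left] at h1
      linarith
    obtain ⟨t₁, ht₁, hrt₁⟩ := hleave
    have hsη : dist (x s) z < η := hs
    obtain ⟨t, hst, htr, hle⟩ := exists_first_eq_of_continuousOn (D := fun t => dist (x t) z) ht₁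
      (continuous_dist.comp_continuousOn ((hx.continuousOn.mono fun τ hτ =>
        mem_Ici.2 (hs0.trans hτ.1)).prodMk continuousOn_const))
      (hsη.trans hηr).le hrt₁
    have h1 := hx.dist_le_of_le_norm_gradient hε hfd hL hs0 hst hg.le
      fun τ hτ => hgrad τ hτ.1 (hle τ hτ)
    have h2 := (hT s hsT).1.2.2
    have h3 := (hT t (hsT.trans hst)).1.2.1
    have h4 : r - η ≤ ‖x t - x s‖ := by
      rw [← dist_eq_norm]
      have := dist_triangle (x t) (x s) z
      linarith
    have h5 : (g - ε) / 2 * (r - η) ≤ (g - ε) / 2 * ‖x t - x s‖ :=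
      mul_le_mul_of_nonneg_left h4 (by linarith)
    linarith
  have t1 : Tendsto (fun η : ℝ => (g - ε) / 2 * (r - η)) (𝓝[>] 0) (𝓝 ((g - ε) / 2 * r)) :=
    (Continuous.tendsto' (by fun_prop) _ _ (by simp)).mono_left nhdsWithin_le_nhds
  have t2 : Tendsto (fun η : ℝ => u - ℓ + 2 * η) (𝓝[>] 0) (𝓝 (u - ℓ)) :=
    (Continuous.tendsto' (by fun_prop) _ _ (by simp)).mono_left nhdsWithin_le_nhds
  exact le_of_tendsto_of_tendsto t1 t2
    (by filter_upwards [Ioo_mem_nhdsGT hr] with η hη using key η hη)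

theorem IsBiasedGradCurve.exists_Icc_subset_vcritSet (hx : IsBiasedGradCurve f ε (Ici 0) x)
    (hε : 0 ≤ ε) (hf : ContDiff ℝ 1 f) {L : ℝ≥0} (hL : LipschitzWith L f)
    (hV : IsClosed (vcritSet f ε)) {M : ℝ} (hM : ∀ t, 0 ≤ t → ‖x t‖ ≤ M) {z : Ep p}
    (hz : MapClusterPt z atTop x) :
    ∃ ℓ u, (∀ η > 0, ∀ᶠ t in atTop, f (x t) ∈ Icc (ℓ - η) (u + η)) ∧ Icc ℓ u ⊆ vcritSet f ε := by
  have hfd : Differentiable ℝ f := hf.differentiable one_ne_zero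
  have hK := (isCompact_closedBall (0 : Ep p) M).image hf.continuous
  have hmem : ∀ᶠ t in atTop, f (x t) ∈ f '' closedBall 0 M := by
    filter_upwards [eventually_ge_atTop 0] with t ht
    exact mem_image_of_mem f (by simpa using hM t ht)
  have hba : IsBoundedUnder (· ≤ ·) atTop fun t => f (x t) := by
    obtain ⟨B, hB⟩ := hK.bddAbove
    exact ⟨B, by simpa using hmem.mono fun t ht => hB ht⟩
  have hbb : IsBoundedUnder (· ≥ ·) atTop fun t => f (x t) := by
    obtain ⟨B, hB⟩ := hK.bddBelow
    exact ⟨B, by simpa using hmem.mono fun t ht => hB ht⟩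
  set ℓ := liminf (fun t => f (x t)) atTop with hℓ
  set u := limsup (fun t => f (x t)) atTop with hu
  have hev : ∀ η > 0, ∀ᶠ t in atTop, f (x t) ∈ Icc (ℓ - η) (u + η) := fun η hη => by
    filter_upwards [eventually_lt_of_lt_liminf (sub_lt_self ℓ hη) hbb,
      eventually_lt_of_limsup_lt (lt_add_of_pos_right u hη) hba] with t h1 h2
    exact ⟨h1.le, h2.le⟩
  refine ⟨ℓ, u, hev, ?_⟩
  have hℓu : ℓ ≤ u := liminf_le_limsup hba hbb
  rcases hℓu.lt_or_eq with hlt | heq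
  · have hIoo : Ioo ℓ u ⊆ vcritSet f ε := by
      intro v hv
      by_contra hvV
      obtain ⟨s, hs0, hs⟩ := frequently_atTop.1
        (frequently_lt_of_liminf_lt hba.isCoboundedUnder_ge hv.1) 0
      obtain ⟨t, hst, ht⟩ := frequently_atTop.1
        (frequently_lt_of_lt_limsup hbb.isCoboundedUnder_le hv.2) s
      exact absurd (hx.le_of_notMem_vcritSet hε hfd hL hV hvV hs0 hst hs.le) (not_le.2 ht)
    rw [← closure_Ioo hlt.ne]
    exact closure_minimal hIoo hV
  · rw [← heq, Icc_self, singleton_subset_iff]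
    have hfz := mem_Icc_of_mapClusterPt hf.continuous hev hz
    have hfz' : f z = ℓ := le_antisymm (hfz.2.trans heq.ge) hfz.1
    refine ⟨z, ?_, hfz'⟩
    by_contra hcon
    obtain ⟨g, hg1, hg2⟩ := exists_between (show ε < ‖gradient f z‖ from not_le.1 hcon)
    have hnhds : {w | g < ‖gradient f w‖} ∈ 𝓝 z :=
      (isOpen_lt continuous_const (continuous_gradient_of_contDiff hf).norm).mem_nhds hg2
    obtain ⟨r, hr, hsub⟩ := nhds_basis_closedBall.mem_iff.1 hnhds
    have := hx.mul_le_of_forall_mapClusterPt hε hf hL hev hz hr hg1 fun w hw _ => hsub hw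
    have hpos : 0 < (g - ε) / 2 * r := by
      have := sub_pos.2 hg1
      positivity
    linarith

end Curve

theorem sub_le_of_forall_infDist_le {s : Set ℝ} (hs : s.Finite) {ℓ u R : ℝ}
    (hR : 0 ≤ R) (h : ∀ v ∈ Icc ℓ u, infDist v s ≤ R) (hne : s.Nonempty) :
    u - ℓ ≤ s.ncard * (2 * R) := by
  have hcov : Icc ℓ u ⊆ ⋃ v ∈ hs.toFinset, closedBall v R := by
    intro v hv
    obtain ⟨w, hw, hvw⟩ := hs.isCompact.exists_infDist_eq_dist hne v
    simp only [Finite.mem_toFinset, mem_iUnion, mem_closedBall, exists_prop]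
    exact ⟨w, hw, hvw ▸ h v hv⟩
  have hvol := (measure_mono hcov).trans (measure_biUnion_finset_le (μ := volume) _ _)
  simp only [Real.volume_Icc, Real.volume_closedBall, Finset.sum_const, nsmul_eq_mul] at hvol
  rw [← ncard_eq_toFinset_card s hs, ← ENNReal.ofReal_natCast,
    ← ENNReal.ofReal_mul (Nat.cast_nonneg _)] at hvol
  exact (ENNReal.ofReal_le_ofReal_iff (by positivity)).1 hvol

theorem stmt7 {p : ℕ} (f : Ep p → ℝ) (hf : ContDiff ℝ 1 f)
    (L : ℝ≥0) (hL : 0 < L) (hLip : LipschitzWith L f)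
    (hvc_ne : (vcritSet f 0).Nonempty) (hvc_fin : (vcritSet f 0).Finite)
    (εb : ℝ) (hεb0 : 0 < εb) (hεb1 : εb < 1)
    (hsegs : ∀ ε : ℝ, 0 ≤ ε → ε ≤ εb → ∃ (n : ℕ) (a b : Fin n → ℝ),
      vcritSet f ε = ⋃ i, Set.Icc (a i) (b i))
    (c θ β : ℝ) (hc : 0 < c) (hθ0 : 0 ≤ θ) (hθ1 : θ < 1) (hβ : 0 < β)
    (hKL : ∀ y : Ep p, f y ∈ vcritSet f εb →
      (infDist (f y) (vcritSet f 0)) ^ θ ≤ c * ‖gradient f y‖)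
    (hMR : ∀ y : Ep p, f y ∈ vcritSet f εb →
      infDist y (critSet f 0) ≤ c * ‖gradient f y‖ ^ β)
    (ρ : ℝ) (hρ : ρ = β / max (θ * (β + 2)) 1)
    :
    ∃ C : ℝ, 0 < C ∧ ∀ ε : ℝ, 0 ≤ ε → ε ≤ εb →
      ∀ x : ℝ → Ep p, IsBiasedGradCurve f ε (Set.Ici 0) x →
        (∃ M : ℝ, ∀ t : ℝ, 0 ≤ t → ‖x t‖ ≤ M) →
        ∀ z : Ep p,
          (∃ ts : ℕ → ℝ, (∀ n, 0 ≤ ts n) ∧ Tendsto ts atTop atTop ∧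
            Tendsto (fun n => x (ts n)) atTop (nhds z)) →
          infDist z (critSet f 0) ≤ C * ε ^ ρ := by
  obtain ⟨_, ⟨y₀, hy₀, rfl⟩⟩ := hvc_ne
  have hvc_ne : (vcritSet f 0).Nonempty := ⟨f y₀, y₀, hy₀, rfl⟩
  have hmono : ∀ ε ε' : ℝ, ε ≤ ε' → vcritSet f ε ⊆ vcritSet f ε' := fun ε ε' h =>
    image_mono fun y (hy : _ ≤ _) => hy.trans h
  have hθ : 0 < θ := by
    refine hθ0.lt_of_ne' fun h => ?_
    have := hKL y₀ (hmono 0 εb hεb0.le ⟨y₀, hy₀, rfl⟩)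
    have hg0 : ‖gradient f y₀‖ = 0 := le_antisymm hy₀ (norm_nonneg _)
    rw [h, Real.rpow_zero, hg0, mul_zero] at this
    linarith
  have hmax : 0 < max (θ * (β + 2)) 1 := lt_max_of_lt_right one_pos
  have hρ0 : 0 < ρ := hρ ▸ div_pos hβ hmax
  have hρβ : ρ ≤ β := hρ ▸ div_le_self hβ.le (le_max_right _ _)
  have hρθ : ρ ≤ 1 / θ * (β / (β + 1)) := by
    rw [hρ, one_div_mul_eq_div, div_div]
    have : (β + 1) * θ ≤ max (θ * (β + 2)) 1 := le_max_of_le_left (by nlinarith)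
    exact div_le_div_of_nonneg_left hβ.le (by positivity) this
  set A : ℝ := 16 * (vcritSet f 0).ncard * c ^ (1 / θ) / c with hA
  have hA0 : 0 ≤ A := by positivity
  refine ⟨2 * c * 4 ^ β + 2 * c * A ^ (β / (β + 1)), by positivity, ?_⟩
  rintro ε hε hεb x hx ⟨M, hM⟩ z ⟨ts, -, hts, htz⟩
  have hz : MapClusterPt z atTop x := MapClusterPt.of_comp hts htz.mapClusterPt
  have hε1 : ε ≤ 1 := hεb.trans hεb1.le
  have hV : IsClosed (vcritSet f ε) := by
    obtain ⟨n, a, b, hab⟩ := hsegs ε hε hεb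
    rw [hab]
    exact isClosed_iUnion_of_finite fun _ => isClosed_Icc
  obtain ⟨ℓ, u, hev, hsub⟩ := hx.exists_Icc_subset_vcritSet hε hf hLip hV hM hz
  have hwidth : u - ℓ ≤ (vcritSet f 0).ncard * (2 * (c * ε) ^ (1 / θ)) := by
    refine sub_le_of_forall_infDist_le hvc_fin (by positivity) (fun v hv => ?_) hvc_ne
    obtain ⟨y, hy, rfl⟩ := hsub hv
    have h1 := hKL y (hmono ε εb hεb ⟨y, hy, rfl⟩)
    have h2 : infDist (f y) (vcritSet f 0) ^ θ ≤ c * ε :=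
      h1.trans (mul_le_mul_of_nonneg_left hy hc.le)
    rw [one_div]
    exact (Real.le_rpow_inv_iff_of_pos infDist_nonneg (by positivity) hθ).2 h2
  set d := infDist z (critSet f 0) with hd
  rcases (infDist_nonneg : 0 ≤ d).eq_or_lt with hd0 | hd0
  · refine hd0.symm.le.trans ?_
    positivity
  set G : ℝ := (d / (2 * c)) ^ β⁻¹ with hG
  have hG0 : 0 < G := by positivity
  have hdG : d = 2 * c * G ^ β := by
    rw [hG, Real.rpow_inv_rpow (by positivity) hβ.ne']
    field_simp
  rcases le_or_gt G (4 * ε) with hGε | hGε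
  · calc d = 2 * c * G ^ β := hdG
      _ ≤ 2 * c * (4 * ε) ^ β := by gcongr
      _ = 2 * c * 4 ^ β * ε ^ β := by
        rw [Real.mul_rpow (by norm_num) hε]
        ring
      _ ≤ 2 * c * 4 ^ β * ε ^ ρ := by
        gcongr 2 * c * 4 ^ β * ?_
        exact Real.rpow_le_rpow_of_exponent_ge' hε hε1 hρ0.le hρβ
      _ ≤ _ := by
        rw [add_mul]
        exact le_add_of_nonneg_right (by positivity)
  have hdrop : (G / 2 - ε) / 2 * (d / 2) ≤ u - ℓ := by
    refine hx.mul_le_of_forall_mapClusterPt hε hf hLip hev hz (by positivity) (by linarith) ?_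
    intro w hw hwc
    have h1 := hMR w (hmono ε εb hεb (hsub (mem_Icc_of_mapClusterPt hf.continuous hev hwc)))
    have h2 : d ≤ infDist w (critSet f 0) + dist z w := infDist_le_infDist_add_dist
    have h3 : dist z w ≤ d / 2 := by rwa [dist_comm]
    have h4 : d / (2 * c) ≤ ‖gradient f w‖ ^ β := by
      rw [div_le_iff₀ (by positivity)]
      linarith
    have h5 : G ≤ ‖gradient f w‖ :=
      (Real.rpow_inv_le_iff_of_pos (by positivity) (norm_nonneg _) hβ).2 h4
    linarith
  have hpow : G ^ (β + 1) ≤ A * ε ^ (1 / θ) := by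
    rw [Real.mul_rpow hc.le hε] at hwidth
    have h1 : G / 8 * (d / 2) ≤ (G / 2 - ε) / 2 * (d / 2) := by
      gcongr ?_ * _
      linarith
    have h2 : G / 8 * (d / 2) = c / 8 * G ^ (β + 1) := by
      rw [hdG, Real.rpow_add_one hG0.ne']
      ring
    rw [hA, div_mul_eq_mul_div, le_div_iff₀ hc]
    linarith
  have hGβ : G ^ β ≤ A ^ (β / (β + 1)) * ε ^ ρ := by
    calc G ^ β = (G ^ (β + 1)) ^ (β / (β + 1)) := by
          rw [← Real.rpow_mul hG0.le]
          congr 1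
          field_simp
      _ ≤ (A * ε ^ (1 / θ)) ^ (β / (β + 1)) := by gcongr
      _ = A ^ (β / (β + 1)) * ε ^ (1 / θ * (β / (β + 1))) := by
          rw [Real.mul_rpow hA0 (by positivity), ← Real.rpow_mul hε]
      _ ≤ A ^ (β / (β + 1)) * ε ^ ρ := by
          gcongr A ^ (β / (β + 1)) * ?_
          exact Real.rpow_le_rpow_of_exponent_ge' hε hε1 hρ0.le hρθ
  calc d = 2 * c * G ^ β := hdG
    _ ≤ 2 * c * (A ^ (β / (β + 1)) * ε ^ ρ) := by gcongr
    _ = 2 * c * A ^ (β / (β + 1)) * ε ^ ρ := by ring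
    _ ≤ _ := by
      rw [add_mul]
      exact le_add_of_nonneg_left (by positivity)
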